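/- arXiv:1310.7063 — 4 statements merged into one kernel-verified Lean document; each statement's English description precedes it below -/
import Mathlib

section
/- Under the stepsize condition α ≤ (1 + λ_n(W))/L_h and β < 1, the stacked gradient vector along the decentralized gradient descent iterates is uniformly bounded: ‖h(k)‖ ≤ D for all k = 0, 1, 2, …, where D := √(2 L_h (Σ_{i=1}^n f_i(0) − Σ_{i=1}^n inf_x f_i(x))). -/
open scoped RealInnerProductSpace

lemma aux_quad {n : ℕ} (W : Matrix (Fin n) (Fin n) ℝ) (hW : W.IsHermitian) (c : ℝ)
    (hc : ∀ i, c ≤ hW.eigenvalues i) (v : Fin n → ℝ) :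
    c * ∑ i, v i ^ 2 ≤ ∑ i, ∑ j, W i j * (v i * v j) := by
  have h1 : (W - c • (1 : Matrix (Fin n) (Fin n) ℝ)).PosSemidef := by
    have h2 : W - c • (1 : Matrix (Fin n) (Fin n) ℝ) =
        (hW.eigenvectorUnitary : Matrix (Fin n) (Fin n) ℝ) *
          Matrix.diagonal (fun i => hW.eigenvalues i - c) *
          (hW.eigenvectorUnitary : Matrix (Fin n) (Fin n) ℝ).conjTranspose := by
      have h3 : Matrix.diagonal (fun i => hW.eigenvalues i - c) =
          Matrix.diagonal hW.eigenvalues - c • (1 : Matrix (Fin n) (Fin n) ℝ) := by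
        rw [Matrix.smul_one_eq_diagonal, Matrix.diagonal_sub]
      have h4 : (hW.eigenvectorUnitary : Matrix (Fin n) (Fin n) ℝ) *
          (hW.eigenvectorUnitary : Matrix (Fin n) (Fin n) ℝ).conjTranspose = 1 :=
        Unitary.coe_mul_star_self _
      have h5 := hW.spectral_theorem
      rw [Unitary.conjStarAlgAut_apply] at h5
      rw [h3, mul_sub, sub_mul, Matrix.mul_smul, Matrix.smul_mul, mul_one, h4]
      congr 1
    rw [h2]
    exact (Matrix.PosSemidef.diagonal (fun i => sub_nonneg.2 (hc i))).mul_mul_conjTranspose_same _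
  have h6 := h1.dotProduct_mulVec_nonneg v
  rw [Matrix.sub_mulVec, dotProduct_sub, Matrix.smul_mulVec, Matrix.one_mulVec, dotProduct_smul] at h6
  simp only [dotProduct, Matrix.mulVec, Pi.star_apply, star_trivial, smul_eq_mul,
    Finset.mul_sum] at h6
  rw [Finset.mul_sum]
  have e1 : ∑ i, c * v i ^ 2 = ∑ i, c * (v i * v i) := by simp only [sq]
  have e2 : ∑ i, ∑ j, W i j * (v i * v j) = ∑ i, ∑ j, v i * (W i j * v j) := by
    refine Finset.sum_congr rfl fun i _ => Finset.sum_congr rfl fun j _ => by ring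
  rw [e1, e2]; linarith

lemma aux_quad_vec {n p : ℕ} (W : Matrix (Fin n) (Fin n) ℝ) (hW : W.IsHermitian) (c : ℝ)
    (hc : ∀ i, c ≤ hW.eigenvalues i) (d : Fin n → EuclideanSpace ℝ (Fin p)) :
    c * ∑ i, ‖d i‖ ^ 2 ≤ ∑ i, ∑ j, W i j * ⟪d i, d j⟫ := by
  have e1 : ∑ i, ‖d i‖ ^ 2 = ∑ a, ∑ i, d i a ^ 2 := by
    rw [Finset.sum_comm]
    simp [EuclideanSpace.norm_sq_eq]
  have e2 : ∑ i, ∑ j, W i j * ⟪d i, d j⟫ = ∑ a, ∑ i, ∑ j, W i j * (d i a * d j a) := by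
    symm
    rw [Finset.sum_comm]
    refine Finset.sum_congr rfl fun i _ => ?_
    rw [Finset.sum_comm]
    refine Finset.sum_congr rfl fun j _ => ?_
    rw [PiLp.inner_apply, Finset.mul_sum]
    refine Finset.sum_congr rfl fun a _ => ?_
    simp [mul_comm]
  rw [e1, e2, Finset.mul_sum]
  exact Finset.sum_le_sum fun a _ => aux_quad W hW c hc fun i => d i a

lemma aux_descent {E : Type*} [NormedAddCommGroup E] [InnerProductSpace ℝ E] [CompleteSpace E]
    (f : E → ℝ) (g : E → E) (L : ℝ) (hL : 0 < L)
    (hg : ∀ z, HasGradientAt f (g z) z) (hl : LipschitzWith L.toNNReal g) (x d : E) :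
    f (x + d) ≤ f x + ⟪g x, d⟫ + L / 2 * ‖d‖ ^ 2 := by
  have hd : ∀ t : ℝ, HasDerivAt (fun t : ℝ => f (x + t • d) - t * ⟪g x, d⟫ - L / 2 * ‖d‖ ^ 2 * t ^ 2)
      (⟪g (x + t • d), d⟫ - ⟪g x, d⟫ - L / 2 * ‖d‖ ^ 2 * (2 * t)) t := by
    intro t
    have h1 : HasDerivAt (fun t : ℝ => x + t • d) d t := by
      simpa using ((hasDerivAt_id t).smul_const d).const_add x
    have h2 := (hg (x + t • d)).hasFDerivAt.comp_hasDerivAt t h1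
    have h3 : HasDerivAt (fun t : ℝ => t * ⟪g x, d⟫) ⟪g x, d⟫ t := by
      simpa using (hasDerivAt_id t).mul_const ⟪g x, d⟫
    have h4 : HasDerivAt (fun t : ℝ => L / 2 * ‖d‖ ^ 2 * t ^ 2) (L / 2 * ‖d‖ ^ 2 * (2 * t)) t := by
      simpa using (hasDerivAt_pow 2 t).const_mul (L / 2 * ‖d‖ ^ 2)
    have h5 := (h2.sub h3).sub h4
    simpa [InnerProductSpace.toDual_apply_apply] using! h5
  have ha := antitoneOn_of_deriv_nonpos (convex_Icc (0 : ℝ) 1)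
    (fun t _ => (hd t).continuousAt.continuousWithinAt)
    (fun t _ => (hd t).differentiableAt.differentiableWithinAt)
    (fun t ht => by
      rw [(hd t).deriv]
      rw [interior_Icc] at ht
      have h1 : ⟪g (x + t • d), d⟫ - ⟪g x, d⟫ ≤ ‖g (x + t • d) - g x‖ * ‖d‖ := by
        rw [← inner_sub_left]; exact real_inner_le_norm _ _
      have h2 := hl.dist_le_mul (x + t • d) x
      rw [dist_eq_norm, dist_eq_norm, Real.coe_toNNReal _ hL.le, add_sub_cancel_left, norm_smul,
        Real.norm_of_nonneg ht.1.le] at h2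
      have h3 := mul_le_mul_of_nonneg_right h2 (norm_nonneg d)
      nlinarith)
  have := ha (Set.left_mem_Icc.2 zero_le_one) (Set.right_mem_Icc.2 zero_le_one) zero_le_one
  simp at this
  linarith

lemma aux_grad {E : Type*} [NormedAddCommGroup E] [InnerProductSpace ℝ E] [CompleteSpace E]
    (f : E → ℝ) (g : E → E) (L : ℝ) (hL : 0 < L) (hb : BddBelow (Set.range f))
    (hg : ∀ z, HasGradientAt f (g z) z) (hl : LipschitzWith L.toNNReal g) (x : E) :
    ‖g x‖ ^ 2 ≤ 2 * L * (f x - ⨅ z, f z) := by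
  have h1 := aux_descent f g L hL hg hl x (-(L⁻¹ • g x))
  have h2 := ciInf_le hb (x + -(L⁻¹ • g x))
  rw [inner_neg_right, inner_smul_right, real_inner_self_eq_norm_sq, norm_neg, norm_smul,
    Real.norm_of_nonneg (inv_nonneg.2 hL.le)] at h1
  have h3 : L / 2 * (L⁻¹ * ‖g x‖) ^ 2 = L⁻¹ * ‖g x‖ ^ 2 / 2 := by field_simp
  rw [h3] at h1
  have h4 : L⁻¹ * ‖g x‖ ^ 2 / 2 ≤ f x - ⨅ z, f z := by linarith
  have h5 := mul_le_mul_of_nonneg_left h4 (by positivity : 0 ≤ 2 * L)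
  have h6 : 2 * L * (L⁻¹ * ‖g x‖ ^ 2 / 2) = ‖g x‖ ^ 2 := by field_simp
  linarith

lemma aux_Q_nonneg {n p : ℕ} (W : Matrix (Fin n) (Fin n) ℝ)
    (hWnonneg : ∀ i j, 0 ≤ W i j)
    (hWrow : ∀ i, ∑ j, W i j = 1)
    (hWcol : ∀ j, ∑ i, W i j = 1) (y : Fin n → EuclideanSpace ℝ (Fin p)) :
    ∑ i, ∑ j, W i j * ⟪y i, y j⟫ ≤ ∑ i, ‖y i‖ ^ 2 := by
  have h1 : ∑ i, ∑ j, W i j * ⟪y i, y j⟫ ≤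
      ∑ i, ∑ j, (W i j * (‖y i‖ ^ 2 / 2) + W i j * (‖y j‖ ^ 2 / 2)) := by
    refine Finset.sum_le_sum fun i _ => Finset.sum_le_sum fun j _ => ?_
    rw [← mul_add]
    refine mul_le_mul_of_nonneg_left ?_ (hWnonneg i j)
    have := real_inner_le_norm (y i) (y j)
    nlinarith [sq_nonneg (‖y i‖ - ‖y j‖)]
  refine h1.trans (le_of_eq ?_)
  simp only [Finset.sum_add_distrib]
  rw [Finset.sum_comm (f := fun i j => W i j * (‖y j‖ ^ 2 / 2))]
  simp only [← Finset.sum_mul, hWrow, hWcol, ← Finset.sum_add_distrib]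
  refine Finset.sum_congr rfl fun i _ => by ring

lemma aux_step {n p : ℕ} (W : Matrix (Fin n) (Fin n) ℝ) (hW : W.IsHermitian)
    (y d : Fin n → EuclideanSpace ℝ (Fin p)) :
    ∑ i, ∑ j, W i j * ⟪y i + d i, y j + d j⟫ = ∑ i, ∑ j, W i j * ⟪y i, y j⟫ +
      2 * ∑ i, ⟪∑ j, W i j • y j, d i⟫ + ∑ i, ∑ j, W i j * ⟪d i, d j⟫ := by
  have e1 : ∑ i, ⟪∑ j, W i j • y j, d i⟫ = ∑ i, ∑ j, W i j * ⟪d i, y j⟫ := by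
    simp only [sum_inner, inner_smul_left, real_inner_comm]; simp
  have e2 : ∑ i, ∑ j, W i j * ⟪y i, d j⟫ = ∑ i, ∑ j, W i j * ⟪d i, y j⟫ := by
    rw [Finset.sum_comm]
    refine Finset.sum_congr rfl fun i _ => Finset.sum_congr rfl fun j _ => ?_
    rw [real_inner_comm]
    congr 1
    simpa using hW.apply i j
  simp only [inner_add_left, inner_add_right, mul_add, Finset.sum_add_distrib]
  rw [e1, e2]; ring



theorem dgd_bounded_gradients
    {n p : ℕ} (hn : 0 < n)
    (f : Fin n → EuclideanSpace ℝ (Fin p) → ℝ)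
    (gf : Fin n → EuclideanSpace ℝ (Fin p) → EuclideanSpace ℝ (Fin p))
    (Lf : Fin n → ℝ) (hLfpos : ∀ i, 0 < Lf i)
    (hconv : ∀ i, ConvexOn ℝ Set.univ (f i))
    (hbdd : ∀ i, BddBelow (Set.range (f i)))
    (hgrad : ∀ i z, HasGradientAt (f i) (gf i z) z)
    (hlip : ∀ i, LipschitzWith (Lf i).toNNReal (gf i))
    (Lh : ℝ) (hLh : Lh = ⨆ i, Lf i)
    (W : Matrix (Fin n) (Fin n) ℝ)
    (hWsymm : W.IsHermitian)
    (hWnonneg : ∀ i j, 0 ≤ W i j)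
    (hWrow : ∀ i, ∑ j, W i j = 1)
    (hWcol : ∀ j, ∑ i, W i j = 1)
    (lam : Fin n → ℝ) (hlamAnti : Antitone lam)
    (hlamEig : ∃ σ : Equiv.Perm (Fin n), lam = hWsymm.eigenvalues ∘ σ)
    (hlam1 : lam ⟨0, hn⟩ = 1)
    (lamN : ℝ) (hlamN : lamN = lam ⟨n - 1, Nat.sub_lt hn Nat.one_pos⟩)
    (hlamNlb : -1 ≤ lamN)
    (β : ℝ) (hβdef : β = ⨆ j : {j : Fin n // j ≠ (⟨0, hn⟩ : Fin n)}, |lam j.1|)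
    (α : ℝ) (hα : 0 < α)
    (x : ℕ → Fin n → EuclideanSpace ℝ (Fin p))
    (hiter : ∀ k i, x (k + 1) i = (∑ j, W i j • x k j) - α • gf i (x k i))
    (hx0 : ∀ i, x 0 i = 0)
    (hstep : α ≤ (1 + lamN) / Lh)
    (hβlt : β < 1)
    (D : ℝ) (hD : D = Real.sqrt (2 * Lh * ((∑ i, f i 0) - ∑ i, ⨅ z, f i z)))
 :
    ∀ k, Real.sqrt (∑ i, ‖gf i (x k i)‖ ^ 2) ≤ D := by
  have hLle : ∀ i, Lf i ≤ Lh := fun i => hLh ▸ le_ciSup (Set.finite_range Lf).bddAbove i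
  have hLpos : 0 < Lh := (hLfpos ⟨0, hn⟩).trans_le (hLle _)
  have hc : ∀ i, lamN ≤ hWsymm.eigenvalues i := by
    obtain ⟨σ, hσ⟩ := hlamEig
    intro i
    have h1 : lam (σ.symm i) = hWsymm.eigenvalues i := by simp [hσ]
    rw [← h1, hlamN]
    apply hlamAnti
    rw [Fin.le_def]
    have := (σ.symm i).2
    simp only
    omega
  have hαL : α * Lh ≤ 1 + lamN := (le_div_iff₀ hLpos).1 hstep
  have hdec : ∀ k, (∑ i, ‖x k i‖ ^ 2) / 2 - (∑ i, ∑ j, W i j * ⟪x k i, x k j⟫) / 2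
      + α * ∑ i, f i (x k i) ≤ α * ∑ i, f i 0 := by
    intro k
    induction k with
    | zero => simp [hx0]
    | succ k ih =>
      refine le_trans ?_ ih
      obtain ⟨d, hd⟩ : ∃ d : Fin n → EuclideanSpace ℝ (Fin p),
          ∀ i, d i = (∑ j, W i j • x k j) - α • gf i (x k i) - x k i := ⟨_, fun _ => rfl⟩
      have hx : ∀ i, x (k + 1) i = x k i + d i := fun i => by rw [hiter, hd]; abel
      simp only [hx]
      rw [aux_step W hWsymm]
      have hq := aux_quad_vec W hWsymm lamN hc d
      have hf : ∑ i, f i (x k i + d i) ≤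
          ∑ i, f i (x k i) + ∑ i, ⟪gf i (x k i), d i⟫ + Lh / 2 * ∑ i, ‖d i‖ ^ 2 := by
        rw [Finset.mul_sum, ← Finset.sum_add_distrib, ← Finset.sum_add_distrib]
        refine Finset.sum_le_sum fun i _ => ?_
        refine (aux_descent (f i) (gf i) (Lf i) (hLfpos i) (hgrad i) (hlip i) _ _).trans ?_
        have := mul_le_mul_of_nonneg_right (hLle i) (sq_nonneg ‖d i‖)
        linarith
      have hn2 : ∑ i, ‖x k i + d i‖ ^ 2 =
          ∑ i, ‖x k i‖ ^ 2 + 2 * ∑ i, ⟪x k i, d i⟫ + ∑ i, ‖d i‖ ^ 2 := by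
        rw [Finset.mul_sum, ← Finset.sum_add_distrib, ← Finset.sum_add_distrib]
        exact Finset.sum_congr rfl fun i _ => norm_add_sq_real _ _
      have hkey : ∑ i, ‖d i‖ ^ 2 = ∑ i, ⟪∑ j, W i j • x k j, d i⟫
          - α * ∑ i, ⟪gf i (x k i), d i⟫ - ∑ i, ⟪x k i, d i⟫ := by
        rw [Finset.mul_sum, ← Finset.sum_sub_distrib, ← Finset.sum_sub_distrib]
        refine Finset.sum_congr rfl fun i _ => ?_
        rw [← real_inner_self_eq_norm_sq]
        nth_rw 1 [hd i]
        rw [inner_sub_left, inner_sub_left, real_inner_smul_left]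
      have hS : 0 ≤ ∑ i, ‖d i‖ ^ 2 := Finset.sum_nonneg fun i _ => sq_nonneg _
      have hf2 := mul_le_mul_of_nonneg_left hf hα.le
      have h7 := mul_le_mul_of_nonneg_right hαL hS
      rw [hn2]
      nlinarith
  intro k
  rw [hD]
  apply Real.sqrt_le_sqrt
  have h1 : ∑ i, f i (x k i) ≤ ∑ i, f i 0 := by
    have := hdec k
    have h2 := aux_Q_nonneg W hWnonneg hWrow hWcol (x k)
    exact le_of_mul_le_mul_left (by linarith) hα
  have h2 : ∑ i, ‖gf i (x k i)‖ ^ 2 ≤ ∑ i, 2 * Lh * (f i (x k i) - ⨅ z, f i z) := by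
    refine Finset.sum_le_sum fun i _ => ?_
    refine (aux_grad (f i) (gf i) (Lf i) (hLfpos i) (hbdd i) (hgrad i) (hlip i) _).trans ?_
    have h3 : 0 ≤ f i (x k i) - ⨅ z, f i z := sub_nonneg.2 (ciInf_le (hbdd i) _)
    have := mul_le_mul_of_nonneg_right (hLle i) h3
    linarith
  refine h2.trans ?_
  rw [← Finset.mul_sum, Finset.sum_sub_distrib]
  exact mul_le_mul_of_nonneg_left (by linarith) (by positivity)
end

section
/- The function ξ_α is differentiable, and its partial gradient with respect to the i-th block at a point [x_{(j)}] ∈ (ℝ^p)^n equals x_{(i)} − Σ_{j=1}^n w_{ij} x_{(j)} + α ∇f_i(x_{(i)}). Consequently, the decentralized gradient descent iteration coincides with the unit-stepsize gradient descent iteration applied to ξ_α: [x_{(i)}(k+1)] = [x_{(i)}(k)] − ∇ξ_α([x_{(i)}(k)]). -/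
open scoped RealInnerProductSpace

theorem dgd_is_gradient_descent_on_lyapunov
    {n p : ℕ} (hn : 0 < n)
    (f : Fin n → EuclideanSpace ℝ (Fin p) → ℝ)
    (gf : Fin n → EuclideanSpace ℝ (Fin p) → EuclideanSpace ℝ (Fin p))
    (Lf : Fin n → ℝ) (hLfpos : ∀ i, 0 < Lf i)
    (hconv : ∀ i, ConvexOn ℝ Set.univ (f i))
    (hbdd : ∀ i, BddBelow (Set.range (f i)))
    (hgrad : ∀ i z, HasGradientAt (f i) (gf i z) z)
    (hlip : ∀ i, LipschitzWith (Lf i).toNNReal (gf i))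
    (Lh : ℝ) (hLh : Lh = ⨆ i, Lf i)
    (W : Matrix (Fin n) (Fin n) ℝ)
    (hWsymm : W.IsHermitian)
    (hWnonneg : ∀ i j, 0 ≤ W i j)
    (hWrow : ∀ i, ∑ j, W i j = 1)
    (hWcol : ∀ j, ∑ i, W i j = 1)
    (lam : Fin n → ℝ) (hlamAnti : Antitone lam)
    (hlamEig : ∃ σ : Equiv.Perm (Fin n), lam = hWsymm.eigenvalues ∘ σ)
    (hlam1 : lam ⟨0, hn⟩ = 1)
    (lamN : ℝ) (hlamN : lamN = lam ⟨n - 1, Nat.sub_lt hn Nat.one_pos⟩)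
    (hlamNlb : -1 ≤ lamN)
    (β : ℝ) (hβdef : β = ⨆ j : {j : Fin n // j ≠ (⟨0, hn⟩ : Fin n)}, |lam j.1|)
    (α : ℝ) (hα : 0 < α)
    (x : ℕ → Fin n → EuclideanSpace ℝ (Fin p))
    (hiter : ∀ k i, x (k + 1) i = (∑ j, W i j • x k j) - α • gf i (x k i))
    (hx0 : ∀ i, x 0 i = 0)
    (Ξ : (PiLp 2 (fun _ : Fin n => EuclideanSpace ℝ (Fin p))) → ℝ)
    (hΞ : ∀ y : PiLp 2 (fun _ : Fin n => EuclideanSpace ℝ (Fin p)), Ξ y = -(1/2) * (∑ i, ∑ j, W i j * ⟪y i, y j⟫)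
        + ∑ i, ((1/2) * ‖y i‖ ^ 2 + α * f i (y i))) :
    (∀ y : PiLp 2 (fun _ : Fin n => EuclideanSpace ℝ (Fin p)),
      HasGradientAt Ξ
        ((WithLp.equiv 2 (∀ _ : Fin n, EuclideanSpace ℝ (Fin p))).symm
          (fun i => y i - (∑ j, W i j • y j) + α • gf i (y i))) y)
    ∧ (∀ k i, x (k + 1) i
        = x k i - (x k i - (∑ j, W i j • x k j) + α • gf i (x k i))) := by
  refine ⟨fun y => ?_, fun k i => by rw [hiter]; abel⟩
  have hΞ' : Ξ = fun y => -(1/2) * (∑ i, ∑ j, W i j * ⟪y i, y j⟫)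
        + ∑ i, ((1/2) * ‖y i‖ ^ 2 + α * f i (y i)) := funext hΞ
  have hp : ∀ i, HasFDerivAt (fun z : PiLp 2 (fun _ : Fin n => EuclideanSpace ℝ (Fin p)) => z i)
      (PiLp.proj 2 (fun _ : Fin n => EuclideanSpace ℝ (Fin p)) i : _ →L[ℝ] _) y :=
    fun i => (PiLp.proj (𝕜 := ℝ) 2 (fun _ : Fin n => EuclideanSpace ℝ (Fin p)) i).hasFDerivAt
  have hf : ∀ i, HasFDerivAt (fun z : PiLp 2 (fun _ : Fin n => EuclideanSpace ℝ (Fin p)) => f i (z i))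
      _ y := fun i => (hgrad i (y i)).hasFDerivAt.comp y (hp i)
  have h1 := (HasFDerivAt.fun_sum (u := Finset.univ) fun i _ =>
    HasFDerivAt.fun_sum (u := Finset.univ) fun j _ => 
      ((hp i).inner ℝ (hp j)).const_mul (W i j)).const_mul (-(1/2) : ℝ)
  have h2 := HasFDerivAt.fun_sum (u := Finset.univ) fun i _ =>
    ((hp i).norm_sq.const_mul (1/2 : ℝ)).add ((hf i).const_mul α)
  have h := h1.add h2
  rw [hasGradientAt_iff_hasFDerivAt, hΞ']
  refine h.congr_fderiv ?_
  ext v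
  have hs : ∀ i j, W i j = W j i := fun i j => by simpa using (hWsymm.apply i j).symm
  have hsw : ∑ i, ∑ j, W i j * ⟪v i, y j⟫ = ∑ i, ∑ j, W i j * ⟪y j, v i⟫ := by
    simp only [real_inner_comm]
  have hsw2 : ∑ i, ∑ j, W i j * ⟪y i, v j⟫ = ∑ i, ∑ j, W i j * ⟪y j, v i⟫ := by
    rw [Finset.sum_comm]
    exact Finset.sum_congr rfl fun i _ => Finset.sum_congr rfl fun j _ => by rw [hs]
  have hin : ∀ a b : PiLp 2 (fun _ : Fin n => EuclideanSpace ℝ (Fin p)),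
      ⟪a, b⟫ = ∑ i, ⟪a i, b i⟫ := fun a b => PiLp.inner_apply a b
  simp [-PiLp.inner_apply, hin, inner_add_left, inner_sub_left, sum_inner, real_inner_smul_left,
    Finset.sum_add_distrib, mul_add, Finset.sum_sub_distrib, hsw, hsw2]
  ring
end

section
/- Suppose β < 1 and the stacked gradients are uniformly bounded, ‖h(k)‖ ≤ D' for all k ≥ 0 and some D' > 0. Then the deviation of each local iterate from the network-wide mean is uniformly bounded: ‖x_{(i)}(k) − x̄(k)‖ ≤ α D'/(1 − β) for all k ≥ 0 and all i = 1,…,n. -/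
open scoped RealInnerProductSpace

theorem spec_aux {n : ℕ} (hn : 0 < n) (W : Matrix (Fin n) (Fin n) ℝ)
    (hW : W.IsHermitian) (hWrow : ∀ i, ∑ j, W i j = 1) (β : ℝ) (hβ : β < 1)
    (i0 : Fin n) (hle : ∀ i, i ≠ i0 → |hW.eigenvalues i| ≤ β)
    (v : Fin n → ℝ) (hv : ∑ i, v i = 0) :
    ∑ i, (∑ j, W i j * v j) ^ 2 ≤ β ^ 2 * ∑ i, v i ^ 2 := by
  let b := hW.eigenvectorBasis
  have key : ∀ i (u : Fin n → ℝ), inner ℝ (b i) (WithLp.toLp 2 (W.mulVec u))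
      = hW.eigenvalues i * inner ℝ (b i) (WithLp.toLp 2 u) := by
    intro i u
    have h1 := hW.mulVec_eigenvectorBasis i
    have hT : W.transpose = W := by simpa [Matrix.IsHermitian] using hW
    simp only [EuclideanSpace.inner_eq_star_dotProduct, star_trivial]
    rw [dotProduct_comm, Matrix.dotProduct_mulVec, ← Matrix.mulVec_transpose, hT]
    change dotProduct (W.mulVec (hW.eigenvectorBasis i).ofLp) u = _
    rw [h1, smul_dotProduct, smul_eq_mul, dotProduct_comm]
  have h1 : W.mulVec (fun _ => (1 : ℝ)) = fun _ => 1 := by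
    ext i; simp [Matrix.mulVec, dotProduct, hWrow]
  have horth : ∀ i, i ≠ i0 → inner ℝ (b i) (WithLp.toLp 2 (fun _ : Fin n => (1 : ℝ))) = 0 := by
    intro i hi
    have := key i (fun _ => 1)
    rw [h1] at this
    have h2 := (le_abs_self _).trans (hle i hi)
    have h3 : (1 - hW.eigenvalues i) * inner ℝ (b i) (WithLp.toLp 2 (fun _ : Fin n => (1 : ℝ))) = 0 := by
      linarith
    rcases mul_eq_zero.1 h3 with h | h
    · linarith
    · exact h
  have hone : WithLp.toLp 2 (fun _ : Fin n => (1 : ℝ))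
      = (inner ℝ (b i0) (WithLp.toLp 2 (fun _ : Fin n => (1 : ℝ))) : ℝ) • b i0 := by
    conv_lhs => rw [← b.sum_repr' (WithLp.toLp 2 (fun _ : Fin n => (1 : ℝ)))]
    exact Finset.sum_eq_single i0 (fun i _ hi => by rw [horth i hi, zero_smul]) (by simp)
  have hv0 : inner ℝ (b i0) (WithLp.toLp 2 v) = 0 := by
    have h4 : inner ℝ (WithLp.toLp 2 (fun _ : Fin n => (1 : ℝ))) (WithLp.toLp 2 v) = 0 := by
      simpa [EuclideanSpace.inner_eq_star_dotProduct, dotProduct] using hv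
    rw [hone, real_inner_smul_left] at h4
    rcases mul_eq_zero.1 h4 with h | h
    · rw [h, zero_smul] at hone
      have := congrArg (fun z : EuclideanSpace ℝ (Fin n) => z ⟨0, hn⟩) hone
      simp at this
    · exact h
  have e1 : ∑ i, (∑ j, W i j * v j) ^ 2 = ‖WithLp.toLp 2 (W.mulVec v)‖ ^ 2 := by
    rw [EuclideanSpace.real_norm_sq_eq]; rfl
  have e2 : ∑ i, v i ^ 2 = ‖WithLp.toLp 2 v‖ ^ 2 := by
    rw [EuclideanSpace.real_norm_sq_eq]
  rw [e1, e2, ← b.sum_sq_norm_inner_right, ← b.sum_sq_norm_inner_right, Finset.mul_sum]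
  refine Finset.sum_le_sum fun i _ => ?_
  rw [key]
  by_cases hi : i = i0
  · subst hi; rw [hv0]; simp
  · rw [norm_mul, mul_pow]
    gcongr
    exact hle i hi

theorem contr_aux {n p : ℕ} (W : Matrix (Fin n) (Fin n) ℝ) (β : ℝ) (hβ : 0 ≤ β)
    (H : ∀ v : Fin n → ℝ, ∑ i, v i = 0 → ∑ i, (∑ j, W i j * v j) ^ 2 ≤ β ^ 2 * ∑ i, v i ^ 2)
    (y : Fin n → EuclideanSpace ℝ (Fin p)) (hy : ∑ i, y i = 0) :
    ‖WithLp.toLp 2 (fun i => ∑ j, W i j • y j)‖ ≤ β * ‖WithLp.toLp 2 y‖ := by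
  refine le_of_sq_le_sq ?_ (by positivity)
  rw [mul_pow, PiLp.norm_sq_eq_of_L2, PiLp.norm_sq_eq_of_L2]
  simp only [EuclideanSpace.real_norm_sq_eq]
  rw [Finset.sum_comm, Finset.sum_comm (s := Finset.univ (α := Fin n)), Finset.mul_sum]
  refine Finset.sum_le_sum fun c _ => ?_
  have := H (fun i => y i c) (by
    have := congrArg (fun z : EuclideanSpace ℝ (Fin p) => z c) hy
    simpa using this)
  simpa using this

theorem center_aux {n p : ℕ} (hn : 0 < n) (g : Fin n → EuclideanSpace ℝ (Fin p)) :
    ‖WithLp.toLp 2 (fun i => g i - (n : ℝ)⁻¹ • ∑ j, g j)‖ ≤ ‖WithLp.toLp 2 g‖ := by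
  refine le_of_sq_le_sq ?_ (by positivity)
  rw [PiLp.norm_sq_eq_of_L2, PiLp.norm_sq_eq_of_L2]
  simp only [norm_sub_sq_real]
  rw [Finset.sum_add_distrib, Finset.sum_sub_distrib, ← Finset.mul_sum, ← sum_inner]
  have hn' : (n : ℝ) ≠ 0 := by positivity
  simp only [inner_smul_right, real_inner_self_eq_norm_sq, Finset.sum_const, Finset.card_univ,
    Fintype.card_fin, nsmul_eq_mul, norm_smul, mul_pow, norm_inv, Real.norm_natCast]
  have : (n : ℝ) * ((n : ℝ)⁻¹ ^ 2 * ‖∑ j, g j‖ ^ 2) = (n : ℝ)⁻¹ * ‖∑ j, g j‖ ^ 2 := by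
    field_simp
  rw [this]
  have : 0 ≤ (n : ℝ)⁻¹ * ‖∑ j, g j‖ ^ 2 := by positivity
  linarith

theorem bounded_deviation_from_mean
    {n p : ℕ} (hn : 0 < n)
    (f : Fin n → EuclideanSpace ℝ (Fin p) → ℝ)
    (gf : Fin n → EuclideanSpace ℝ (Fin p) → EuclideanSpace ℝ (Fin p))
    (Lf : Fin n → ℝ) (hLfpos : ∀ i, 0 < Lf i)
    (hconv : ∀ i, ConvexOn ℝ Set.univ (f i))
    (hbdd : ∀ i, BddBelow (Set.range (f i)))
    (hgrad : ∀ i z, HasGradientAt (f i) (gf i z) z)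
    (hlip : ∀ i, LipschitzWith (Lf i).toNNReal (gf i))
    (Lh : ℝ) (hLh : Lh = ⨆ i, Lf i)
    (W : Matrix (Fin n) (Fin n) ℝ)
    (hWsymm : W.IsHermitian)
    (hWnonneg : ∀ i j, 0 ≤ W i j)
    (hWrow : ∀ i, ∑ j, W i j = 1)
    (hWcol : ∀ j, ∑ i, W i j = 1)
    (lam : Fin n → ℝ) (hlamAnti : Antitone lam)
    (hlamEig : ∃ σ : Equiv.Perm (Fin n), lam = hWsymm.eigenvalues ∘ σ)
    (hlam1 : lam ⟨0, hn⟩ = 1)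
    (lamN : ℝ) (hlamN : lamN = lam ⟨n - 1, Nat.sub_lt hn Nat.one_pos⟩)
    (hlamNlb : -1 ≤ lamN)
    (β : ℝ) (hβdef : β = ⨆ j : {j : Fin n // j ≠ (⟨0, hn⟩ : Fin n)}, |lam j.1|)
    (α : ℝ) (hα : 0 < α)
    (x : ℕ → Fin n → EuclideanSpace ℝ (Fin p))
    (hiter : ∀ k i, x (k + 1) i = (∑ j, W i j • x k j) - α • gf i (x k i))
    (hx0 : ∀ i, x 0 i = 0)
    (hβlt : β < 1)
    (D' : ℝ) (hD'pos : 0 < D')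
    (hhbnd : ∀ k, Real.sqrt (∑ i, ‖gf i (x k i)‖ ^ 2) ≤ D')
    (xbar : ℕ → EuclideanSpace ℝ (Fin p)) (hxbar : ∀ k, xbar k = (n : ℝ)⁻¹ • ∑ i, x k i)
 :
    ∀ k, ∀ i, ‖x k i - xbar k‖ ≤ α * D' / (1 - β) := by
  have hn' : (n : ℝ) ≠ 0 := by positivity
  have hβ0 : 0 ≤ β := by
    rw [hβdef]; exact Real.iSup_nonneg fun _ => abs_nonneg _
  obtain ⟨σ, hσ⟩ := hlamEig
  have hle : ∀ i, i ≠ σ ⟨0, hn⟩ → |hWsymm.eigenvalues i| ≤ β := by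
    intro i hi
    have h1 : σ.symm i ≠ ⟨0, hn⟩ := by
      intro h; apply hi; rw [← h]; simp
    have h2 := le_ciSup (f := fun j : {j : Fin n // j ≠ (⟨0, hn⟩ : Fin n)} => |lam j.1|)
      (Set.finite_range _).bddAbove ⟨σ.symm i, h1⟩
    rw [← hβdef] at h2
    simpa [hσ] using h2
  have H := spec_aux hn W hWsymm hWrow β hβlt _ hle
  have hB : 0 < 1 - β := by linarith
  have hmean : ∀ k, ∑ i, (x k i - xbar k) = 0 := by
    intro k
    rw [Finset.sum_sub_distrib, hxbar]
    simp only [Finset.sum_const, Finset.card_univ, Fintype.card_fin]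
    rw [← Nat.cast_smul_eq_nsmul ℝ, smul_smul, mul_inv_cancel₀ hn', one_smul, sub_self]
  have hstep : ∀ k, WithLp.toLp 2 (fun i => x (k+1) i - xbar (k+1))
      = WithLp.toLp 2 (fun i => ∑ j, W i j • (x k j - xbar k))
        - α • WithLp.toLp 2 (fun i => gf i (x k i) - (n : ℝ)⁻¹ • ∑ j, gf j (x k j)) := by
    intro k
    have hb : xbar (k+1) = xbar k - α • ((n : ℝ)⁻¹ • ∑ j, gf j (x k j)) := by
      rw [hxbar, hxbar]
      simp only [hiter]
      rw [Finset.sum_sub_distrib, Finset.sum_comm]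
      simp only [← Finset.sum_smul, hWcol, one_smul, ← Finset.smul_sum]
      rw [smul_sub, smul_comm α]
    ext1 i
    simp only [WithLp.ofLp_sub, WithLp.ofLp_smul, Pi.sub_apply, Pi.smul_apply]
    rw [hb, hiter]
    simp only [smul_sub, Finset.sum_sub_distrib, ← Finset.sum_smul, hWrow, one_smul]
    abel
  have main : ∀ k, ‖WithLp.toLp 2 (fun i => x k i - xbar k)‖ ≤ α * D' / (1 - β) := by
    intro k
    induction k with
    | zero =>
      have : (fun i => x 0 i - xbar 0) = 0 := by
        funext i; simp [hxbar, hx0]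
      rw [this]
      simp only [WithLp.toLp_zero, norm_zero]
      positivity
    | succ k ih =>
      rw [hstep]
      have h1 := contr_aux W β hβ0 H _ (hmean k)
      have h2 := center_aux hn (fun i => gf i (x k i))
      have h3 : ‖WithLp.toLp 2 (fun i => gf i (x k i))‖ ≤ D' := by
        rw [PiLp.norm_eq_of_L2]; exact hhbnd k
      have h4 := norm_sub_le (WithLp.toLp 2 (fun i => ∑ j, W i j • (x k j - xbar k)))
        (α • WithLp.toLp 2 (fun i => gf i (x k i) - (n : ℝ)⁻¹ • ∑ j, gf j (x k j)))
      rw [norm_smul, Real.norm_of_nonneg hα.le] at h4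
      have h5 := mul_le_mul_of_nonneg_left (h2.trans h3) hα.le
      have h6 := mul_le_mul_of_nonneg_left ih hβ0
      have h7 : β * (α * D' / (1 - β)) + α * D' = α * D' / (1 - β) := by
        field_simp; ring
      linarith
  intro k i
  exact (PiLp.norm_apply_le (WithLp.toLp 2 (fun i => x k i - xbar k)) i).trans (main k)
end

section
/- Suppose β < 1, the decentralized gradient descent iteration is started from an arbitrary initialization [x_{(i)}(0)] ∈ (ℝ^p)^n, and the stacked gradients are uniformly bounded, ‖h(k)‖ ≤ D' for all k ≥ 0 and some D' > 0. Then for all k ≥ 0 and all i = 1,…,n, ‖x_{(i)}(k) − x̄(k)‖ ≤ β^k ‖[x_{(i)}(0)]‖ + α D'/(1 − β). -/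
open scoped RealInnerProductSpace

lemma aux_contr {n : ℕ} (W : Matrix (Fin n) (Fin n) ℝ) (hW : W.IsHermitian)
    (hrow : ∀ i, ∑ j, W i j = 1) (j0 : Fin n) (β : ℝ) (hβ0 : 0 ≤ β) (hβ : β < 1)
    (hb : ∀ j, j ≠ j0 → |hW.eigenvalues j| ≤ β)
    (v : Fin n → ℝ) (hv : ∑ i, v i = 0) :
    ∑ i, (∑ j, W i j * v j) ^ 2 ≤ β ^ 2 * ∑ i, v i ^ 2 := by
  set u := hW.eigenvectorBasis with hu
  -- self-adjointness on eigenvectors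
  have key : ∀ j (w : Fin n → ℝ), ⟪u j, WithLp.toLp 2 (W.mulVec w)⟫
      = hW.eigenvalues j * ⟪u j, WithLp.toLp 2 w⟫ := by
    intro j w
    have h1 := hW.mulVec_eigenvectorBasis j
    have hT : W.transpose = W := by
      have := hW.eq
      rwa [Matrix.conjTranspose_eq_transpose_of_trivial] at this
    simp only [EuclideanSpace.inner_eq_star_dotProduct, star_trivial]
    rw [dotProduct_comm, Matrix.dotProduct_mulVec, ← Matrix.mulVec_transpose, hT, h1,
      smul_dotProduct, dotProduct_comm, smul_eq_mul]
  have hone : W.mulVec (fun _ => (1:ℝ)) = fun _ => 1 := by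
    funext i
    simp [Matrix.mulVec, dotProduct, hrow]
  have horth : ∀ j, j ≠ j0 → ⟪u j, WithLp.toLp 2 (fun _ : Fin n => (1:ℝ))⟫ = 0 := by
    intro j hj
    have h := key j (fun _ => 1)
    rw [hone] at h
    have h2 := (abs_le.1 (hb j hj)).2
    have : (1 - hW.eigenvalues j) * ⟪u j, WithLp.toLp 2 (fun _ : Fin n => (1:ℝ))⟫ = 0 := by linarith
    rcases mul_eq_zero.1 this with h3 | h3
    · linarith
    · exact h3
  set e : EuclideanSpace ℝ (Fin n) := WithLp.toLp 2 (fun _ : Fin n => (1:ℝ)) with he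
  have hsum : ⟪u j0, e⟫ • u j0 = e := by
    have hr := u.sum_repr' e
    rw [Finset.sum_eq_single j0] at hr
    · exact hr
    · intro j _ hj
      rw [horth j hj, zero_smul]
    · simp
  have hc : ⟪u j0, e⟫ ≠ 0 := by
    intro h
    rw [h, zero_smul] at hsum
    have := congrArg (fun z : EuclideanSpace ℝ (Fin n) => z j0) hsum
    simp [he] at this
  have hev : ⟪e, WithLp.toLp 2 v⟫ = 0 := by
    simp [he, PiLp.inner_apply, hv]
  have h0 : ⟪u j0, WithLp.toLp 2 v⟫ = 0 := by
    rw [← hsum, real_inner_smul_left] at hev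
    exact (mul_eq_zero.1 hev).resolve_left hc
  have e1 : ∑ i, (∑ j, W i j * v j) ^ 2 = ‖WithLp.toLp 2 (W.mulVec v)‖ ^ 2 := by
    rw [EuclideanSpace.real_norm_sq_eq]; rfl
  have e2 : ∑ i, v i ^ 2 = ‖WithLp.toLp 2 v‖ ^ 2 := by
    rw [EuclideanSpace.real_norm_sq_eq]
  rw [e1, e2, ← u.sum_sq_norm_inner_right, ← u.sum_sq_norm_inner_right, Finset.mul_sum]
  refine Finset.sum_le_sum fun j _ => ?_
  rw [key]
  by_cases hj : j = j0
  · rw [hj, h0]; simp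
  · rw [norm_mul, mul_pow]
    have := hb j hj
    rw [Real.norm_eq_abs]
    gcongr

lemma aux_contr_vec {n p : ℕ} (W : Matrix (Fin n) (Fin n) ℝ) (hW : W.IsHermitian)
    (hrow : ∀ i, ∑ j, W i j = 1) (j0 : Fin n) (β : ℝ) (hβ0 : 0 ≤ β) (hβ : β < 1)
    (hb : ∀ j, j ≠ j0 → |hW.eigenvalues j| ≤ β)
    (y : Fin n → EuclideanSpace ℝ (Fin p)) (hv : ∑ i, y i = 0) :
    ∑ i, ‖∑ j, W i j • y j‖ ^ 2 ≤ β ^ 2 * ∑ i, ‖y i‖ ^ 2 := by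
  simp only [EuclideanSpace.real_norm_sq_eq]
  rw [Finset.sum_comm, Finset.sum_comm (f := fun i c => (y i) c ^ 2), Finset.mul_sum]
  refine Finset.sum_le_sum fun c _ => ?_
  have := aux_contr W hW hrow j0 β hβ0 hβ hb (fun i => y i c) (by
    have := congrArg (fun z : EuclideanSpace ℝ (Fin p) => z c) hv
    simpa using this)
  simpa using this

lemma aux_center {n p : ℕ} (hn : 0 < n) (g : Fin n → EuclideanSpace ℝ (Fin p)) :
    ∑ i, ‖g i - (n : ℝ)⁻¹ • ∑ j, g j‖ ^ 2 ≤ ∑ i, ‖g i‖ ^ 2 := by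
  set m := (n : ℝ)⁻¹ • ∑ j, g j with hm
  have hn' : (n : ℝ) ≠ 0 := by positivity
  have hs : ∑ j, g j = (n : ℝ) • m := by rw [hm, smul_inv_smul₀ hn']
  have : ∑ i, ‖g i - m‖ ^ 2 = ∑ i, ‖g i‖ ^ 2 - n * ‖m‖ ^ 2 := by
    simp only [norm_sub_sq_real, Finset.sum_add_distrib, Finset.sum_sub_distrib, ← Finset.mul_sum,
      ← sum_inner, hs, real_inner_smul_left, real_inner_self_eq_norm_sq]
    simp
    ring
  rw [this]
  have : 0 ≤ (n : ℝ) * ‖m‖ ^ 2 := by positivity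
  linarith


theorem bounded_deviation_from_mean_general_init
    {n p : ℕ} (hn : 0 < n)
    (f : Fin n → EuclideanSpace ℝ (Fin p) → ℝ)
    (gf : Fin n → EuclideanSpace ℝ (Fin p) → EuclideanSpace ℝ (Fin p))
    (Lf : Fin n → ℝ) (hLfpos : ∀ i, 0 < Lf i)
    (hconv : ∀ i, ConvexOn ℝ Set.univ (f i))
    (hbdd : ∀ i, BddBelow (Set.range (f i)))
    (hgrad : ∀ i z, HasGradientAt (f i) (gf i z) z)
    (hlip : ∀ i, LipschitzWith (Lf i).toNNReal (gf i))
    (Lh : ℝ) (hLh : Lh = ⨆ i, Lf i)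
    (W : Matrix (Fin n) (Fin n) ℝ)
    (hWsymm : W.IsHermitian)
    (hWnonneg : ∀ i j, 0 ≤ W i j)
    (hWrow : ∀ i, ∑ j, W i j = 1)
    (hWcol : ∀ j, ∑ i, W i j = 1)
    (lam : Fin n → ℝ) (hlamAnti : Antitone lam)
    (hlamEig : ∃ σ : Equiv.Perm (Fin n), lam = hWsymm.eigenvalues ∘ σ)
    (hlam1 : lam ⟨0, hn⟩ = 1)
    (lamN : ℝ) (hlamN : lamN = lam ⟨n - 1, Nat.sub_lt hn Nat.one_pos⟩)
    (hlamNlb : -1 ≤ lamN)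
    (β : ℝ) (hβdef : β = ⨆ j : {j : Fin n // j ≠ (⟨0, hn⟩ : Fin n)}, |lam j.1|)
    (α : ℝ) (hα : 0 < α)
    (x : ℕ → Fin n → EuclideanSpace ℝ (Fin p))
    (hiter : ∀ k i, x (k + 1) i = (∑ j, W i j • x k j) - α • gf i (x k i))
    (hβlt : β < 1)
    (D' : ℝ) (hD'pos : 0 < D')
    (hhbnd : ∀ k, Real.sqrt (∑ i, ‖gf i (x k i)‖ ^ 2) ≤ D')
    (xbar : ℕ → EuclideanSpace ℝ (Fin p)) (hxbar : ∀ k, xbar k = (n : ℝ)⁻¹ • ∑ i, x k i)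
 :
    ∀ k, ∀ i, ‖x k i - xbar k‖
      ≤ β ^ k * Real.sqrt (∑ i, ‖x 0 i‖ ^ 2) + α * D' / (1 - β) := by
  obtain ⟨σ, hσ⟩ := hlamEig
  have hβ0 : 0 ≤ β := by
    rw [hβdef]; exact Real.iSup_nonneg fun _ => abs_nonneg _
  have hb : ∀ j, j ≠ σ ⟨0, hn⟩ → |hWsymm.eigenvalues j| ≤ β := by
    intro j hj
    have hne : σ.symm j ≠ ⟨0, hn⟩ := by
      intro h; apply hj; rw [← h]; simp
    have h := le_ciSup (f := fun j : {j : Fin n // j ≠ (⟨0, hn⟩ : Fin n)} => |lam j.1|)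
      (Set.finite_range _).bddAbove ⟨σ.symm j, hne⟩
    rw [← hβdef] at h
    simpa [hσ] using h
  have hn' : (n : ℝ) ≠ 0 := by positivity
  have hzero : ∀ k, ∑ i, (x k i - xbar k) = 0 := by
    intro k
    rw [Finset.sum_sub_distrib, hxbar]
    simp only [Finset.sum_const, Finset.card_univ, Fintype.card_fin]
    rw [← Nat.cast_smul_eq_nsmul ℝ, smul_inv_smul₀ hn', sub_self]
  have hbar : ∀ k, xbar (k + 1) = xbar k - α • ((n : ℝ)⁻¹ • ∑ j, gf j (x k j)) := by
    intro k
    rw [hxbar, hxbar]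
    simp only [hiter, Finset.sum_sub_distrib]
    rw [Finset.sum_comm]
    simp only [← Finset.sum_smul, hWcol, one_smul, ← Finset.smul_sum]
    rw [smul_sub, smul_comm]
  have hstep : ∀ k i, x (k + 1) i - xbar (k + 1) = (∑ j, W i j • (x k j - xbar k))
      - α • (gf i (x k i) - (n : ℝ)⁻¹ • ∑ j, gf j (x k j)) := by
    intro k i
    rw [hbar, hiter]
    simp only [smul_sub, Finset.sum_sub_distrib, ← Finset.sum_smul, hWrow, one_smul]
    abel
  let N : (Fin n → EuclideanSpace ℝ (Fin p)) → ℝ := fun y => Real.sqrt (∑ i, ‖y i‖ ^ 2)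
  have hN : ∀ y, N y = ‖(WithLp.toLp 2 y : PiLp 2 fun _ : Fin n => EuclideanSpace ℝ (Fin p))‖ := by
    intro y
    rw [PiLp.norm_eq_of_L2]
  have h1β : 0 < 1 - β := by linarith
  have main : ∀ k, N (fun i => x k i - xbar k) ≤
      β ^ k * Real.sqrt (∑ i, ‖x 0 i‖ ^ 2) + α * D' / (1 - β) := by
    intro k
    induction k with
    | zero =>
      have h1 : N (fun i => x 0 i - xbar 0) ≤ Real.sqrt (∑ i, ‖x 0 i‖ ^ 2) := by
        apply Real.sqrt_le_sqrt
        simp only [hxbar]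
        exact aux_center hn _
      have : 0 ≤ α * D' / (1 - β) := by positivity
      rw [pow_zero, one_mul]
      linarith
    | succ k ih =>
      have hA : N (fun i => ∑ j, W i j • (x k j - xbar k)) ≤ β * N (fun i => x k i - xbar k) := by
        apply Real.sqrt_le_iff.2
        refine ⟨mul_nonneg hβ0 (Real.sqrt_nonneg _), ?_⟩
        rw [mul_pow, Real.sq_sqrt (by positivity)]
        exact aux_contr_vec W hWsymm hWrow _ β hβ0 hβlt hb _ (hzero k)
      have hB : N (fun i => gf i (x k i) - (n : ℝ)⁻¹ • ∑ j, gf j (x k j)) ≤ D' :=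
        (Real.sqrt_le_sqrt (aux_center hn _)).trans (hhbnd k)
      have hC : N (fun i => x (k+1) i - xbar (k+1)) ≤ N (fun i => ∑ j, W i j • (x k j - xbar k))
          + α * N (fun i => gf i (x k i) - (n : ℝ)⁻¹ • ∑ j, gf j (x k j)) := by
        rw [hN, hN, hN, ← abs_of_pos hα, ← Real.norm_eq_abs, ← norm_smul]
        refine le_trans (le_of_eq ?_) (norm_sub_le _ _)
        congr 1
        ext1 i
        exact hstep k i
      have hD : β * (β ^ k * Real.sqrt (∑ i, ‖x 0 i‖ ^ 2) + α * D' / (1 - β)) + α * D'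
          = β ^ (k+1) * Real.sqrt (∑ i, ‖x 0 i‖ ^ 2) + α * D' / (1 - β) := by
        field_simp
        ring
      have h1 := mul_le_mul_of_nonneg_left ih hβ0
      have h2 := mul_le_mul_of_nonneg_left hB hα.le
      linarith
  intro k i
  refine le_trans ?_ (main k)
  apply Real.le_sqrt_of_sq_le
  exact Finset.single_le_sum (f := fun i => ‖x k i - xbar k‖ ^ 2) (fun _ _ => by positivity)
    (Finset.mem_univ i)
end
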